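/- Let k be a field of characteristic zero. There exists no function g : ℤ × ℤ → k satisfying both (i) g(i,j) − g(j,i) = i − j (integers coerced into k) for all i, j ∈ ℤ, and (ii) the associativity relation g(i,j)·g(i+j, m) = g(j,m)·g(i, j+m) for all i, j, m ∈ ℤ. Consequently, the centerless Virasoro algebra, with bracket [e_i, e_j] = (i−j)e_{i+j}, is not the commutator algebra of any ℤ-graded associative multiplication e_i e_j = g(i,j) e_{i+j}. -/

import Mathlib

/-- there is no function `g : ℤ × ℤ → k` (`k` a field of characteristic
zero) with `g(i,j) − g(j,i) = i − j` and `g(i,j)g(i+j,m) = g(j,m)g(i,j+m)`: the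
centerless Virasoro algebra is not the commutator algebra of any ℤ-graded associative
multiplication `e_i e_j = g(i,j) e_{i+j}`. -/
theorem stmt16 {k : Type*} [Field k] [CharZero k] :
    ¬ ∃ g : ℤ → ℤ → k,
        (∀ i j : ℤ, g i j - g j i = (i : k) - (j : k)) ∧
        (∀ i j m : ℤ, g i j * g (i + j) m = g j m * g i (j + m)) := by
  rintro ⟨g, h, H⟩
  have a1 := H 0 0 1
  have b1 := H 1 0 0
  have a2 := H 0 0 2
  have b2 := H 2 0 0
  have d1 := h 1 0
  have d2 := h 2 0
  norm_num at a1 b1 a2 b2 d1 d2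
  have e1 : g 1 0 = g 0 1 + 1 := by linear_combination d1
  have e2 : g 2 0 = g 0 2 + 2 := by linear_combination d2
  have A1 : g 0 0 * g 0 1 = g 0 1 * g 0 1 := H 0 0 1
  have B1 : g 1 0 * g 1 0 = g 0 0 * g 1 0 := H 1 0 0
  have A2 : g 0 0 * g 0 2 = g 0 2 * g 0 2 := H 0 0 2
  have B2 : g 2 0 * g 2 0 = g 0 0 * g 2 0 := H 2 0 0
  clear a1 a2 b1 b2
  rw [e1] at B1
  rw [e2] at B2
  generalize g 0 0 = c at *
  generalize g 0 1 = x at *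
  generalize g 0 2 = y at *
  have c1 : c = 2 * x + 1 := by linear_combination -B1 - A1
  have c2 : c = 2 * y + 2 := by
    have : (2 : k) * (c - (2 * y + 2)) = 0 := by linear_combination -B2 - A2
    have h2 : (2 : k) ≠ 0 := two_ne_zero
    exact sub_eq_zero.mp ((mul_eq_zero.mp this).resolve_left h2)
  have s1 : c ^ 2 = 1 := by
    rw [c1] at A1 ⊢
    linear_combination 4 * A1
  have s2 : c ^ 2 = 4 := by
    rw [c2] at A2 ⊢
    linear_combination 4 * A2
  have : (3 : k) = 0 := by linear_combination s1 - s2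
  exact three_ne_zero this
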